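/- Fix a positive integer k and let 𝒫_k denote the set of infinite real symmetric matrices A = (a_ij)_{i,j=1}^∞ such that there exists N with: for every n ≥ N, the leading principal n×n submatrix of A has exactly k negative eigenvalues, counted with multiplicity. For a function f : ℝ → ℝ, the entrywise transform f[−] (applying f to every entry) maps 𝒫_k into 𝒫_k if and only if either f(x) = c·x for all x ∈ ℝ for some constant c > 0, or k = 1 and f(x) = −c for all x ∈ ℝ for some constant c > 0. -/

import Mathlib

/-- The number of negative eigenvalues (with multiplicity) of a real symmetric
(Hermitian) matrix; junk value `0` if the matrix is not Hermitian. -/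
noncomputable def negEigCount {n : Type*} [Fintype n] [DecidableEq n]
    (A : Matrix n n ℝ) : ℕ :=
  if hA : A.IsHermitian then Nat.card {i // hA.eigenvalues i < 0} else 0

/-- `𝒫ₖ`: infinite real symmetric matrices whose leading principal `n × n` submatrices have
exactly `k` negative eigenvalues for all sufficiently large `n`. -/
def MemP (k : ℕ) (a : ℕ → ℕ → ℝ) : Prop :=
  (∀ i j, a i j = a j i) ∧
  ∃ N : ℕ, ∀ n : ℕ, N ≤ n →
    negEigCount (Matrix.of fun i j : Fin n => a i.1 j.1) = k

open Matrix Module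

theorem isHermitian_blockDiagonal_const {ι κ : Type*} [DecidableEq κ] {A : Matrix ι ι ℝ}
    (hA : A.IsHermitian) : (blockDiagonal fun _ : κ => A).IsHermitian := by
  rw [Matrix.IsHermitian, Matrix.blockDiagonal_conjTranspose, hA.eq]

section NegEigCount

variable {ι κ : Type*} [Fintype ι] [DecidableEq ι] [Fintype κ] [DecidableEq κ]

theorem negEigCount_eq_sigNeg {A : Matrix ι ι ℝ} (hA : A.IsHermitian) :
    negEigCount A = sigNeg A.toQuadraticForm' := by
  have hequiv : A.toQuadraticForm'.Equivalent
      (QuadraticMap.weightedSumSquares ℝ hA.eigenvalues) := by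
    refine QuadraticMap.Equivalent.symm
      ⟨⟨Matrix.UnitaryGroup.toLinearEquiv hA.eigenvectorUnitary, fun x => ?_⟩⟩
    have hD := hA.conjStarAlgAut_star_eigenvectorUnitary
    rw [Unitary.conjStarAlgAut_star_apply] at hD
    change A.toQuadraticForm' ((hA.eigenvectorUnitary : Matrix ι ι ℝ) *ᵥ x) = _
    rw [QuadraticMap.weightedSumSquares_apply]
    have hform (y : ι → ℝ) : A.toQuadraticForm' y = y ⬝ᵥ A *ᵥ y :=
      Matrix.toLinearMap₂'_apply' A y y
    have hstar : (star (hA.eigenvectorUnitary : Matrix ι ι ℝ)) =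
        (hA.eigenvectorUnitary : Matrix ι ι ℝ)ᵀ := by
      simp [Matrix.star_eq_conjTranspose]
    rw [hform, dotProduct_comm, ← Matrix.dotProduct_transpose_mulVec, ← hstar,
      Matrix.mulVec_mulVec, Matrix.mulVec_mulVec, hD]
    simp [dotProduct, Matrix.mulVec_diagonal]
    exact Finset.sum_congr rfl fun i _ => by ring
  rw [QuadraticForm.sigNeg_of_equiv_weightedSumSquares hequiv, negEigCount, dif_pos hA]
  rfl

theorem finrank_le_negEigCount {A : Matrix ι ι ℝ} (hA : A.IsHermitian) {W : Type*}
    [AddCommGroup W] [Module ℝ W] (l : W →ₗ[ℝ] ι → ℝ)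
    (h : ∀ x, x ≠ 0 → l x ⬝ᵥ A *ᵥ l x < 0) : finrank ℝ W ≤ negEigCount A := by
  have hinj : Function.Injective l := by
    rw [← LinearMap.ker_eq_bot, LinearMap.ker_eq_bot']
    intro x hx
    by_contra hne
    simpa [hx] using h x hne
  rw [negEigCount_eq_sigNeg hA, ← LinearMap.finrank_range_of_inj hinj]
  apply le_sigNeg_of_negDef
  rintro ⟨_, x, rfl⟩ hx
  have hx0 : x ≠ 0 := by
    rintro rfl
    exact hx (Subtype.ext (map_zero l))
  have := h x hx0
  have hform : A.toQuadraticForm' (l x) = l x ⬝ᵥ A *ᵥ l x :=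
    Matrix.toLinearMap₂'_apply' A _ _
  simp only [QuadraticMap.restrict_apply, _root_.neg_apply, hform]
  linarith

theorem exists_negative_subspace {A : Matrix ι ι ℝ} (hA : A.IsHermitian) :
    ∃ W : Submodule ℝ (ι → ℝ), finrank ℝ W = negEigCount A ∧
      ∀ x ∈ W, x ≠ 0 → x ⬝ᵥ A *ᵥ x < 0 := by
  obtain ⟨W, hW, hneg⟩ := exists_finrank_eq_sigNeg_and_negDef A.toQuadraticForm'
  refine ⟨W, by rw [hW, negEigCount_eq_sigNeg hA], fun x hx hx0 => ?_⟩
  have := hneg ⟨x, hx⟩ (by simpa using hx0)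
  have hform : A.toQuadraticForm' x = x ⬝ᵥ A *ᵥ x := Matrix.toLinearMap₂'_apply' A _ _
  simp only [QuadraticMap.restrict_apply, _root_.neg_apply, hform] at this
  linarith

theorem negEigCount_add_finrank_le {A : Matrix ι ι ℝ} (hA : A.IsHermitian)
    (V : Submodule ℝ (ι → ℝ)) (hV : ∀ x ∈ V, 0 ≤ x ⬝ᵥ A *ᵥ x) :
    negEigCount A + finrank ℝ V ≤ Fintype.card ι := by
  obtain ⟨W, hW, hneg⟩ := exists_negative_subspace hA
  rw [← hW, ← Module.finrank_fintype_fun_eq_card ℝ]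
  apply Submodule.finrank_add_finrank_le_of_disjoint
  rw [Submodule.disjoint_def]
  intro x hxW hxV
  by_contra hx
  exact absurd (hneg x hxW hx) (hV x hxV).not_gt

theorem negEigCount_le_one {A : Matrix ι ι ℝ} (hA : A.IsHermitian) (l : (ι → ℝ) →ₗ[ℝ] ℝ)
    (h : ∀ x, l x = 0 → 0 ≤ x ⬝ᵥ A *ᵥ x) : negEigCount A ≤ 1 := by
  have h1 := negEigCount_add_finrank_le hA (LinearMap.ker l) h
  have h2 := l.finrank_range_add_finrank_ker
  have h3 := (LinearMap.range l).finrank_le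
  rw [Module.finrank_self] at h3
  rw [Module.finrank_fintype_fun_eq_card] at h2
  omega

theorem one_le_negEigCount {A : Matrix ι ι ℝ} (hA : A.IsHermitian) {x : ι → ℝ}
    (hx : x ⬝ᵥ A *ᵥ x < 0) : 1 ≤ negEigCount A := by
  rw [← Module.finrank_self ℝ]
  refine finrank_le_negEigCount hA (LinearMap.toSpanSingleton ℝ _ x) fun t ht => ?_
  have : 0 < t * t := mul_self_pos.2 ht
  simp only [LinearMap.toSpanSingleton_apply, mulVec_smul, dotProduct_smul, smul_dotProduct,
    smul_eq_mul]
  nlinarith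

theorem diag_neg_of_negEigCount_eq_card {A : Matrix ι ι ℝ} (hA : A.IsHermitian)
    (h : negEigCount A = Fintype.card ι) (i : ι) : A i i < 0 := by
  by_contra! hi
  have h1 := negEigCount_add_finrank_le hA (Submodule.span ℝ {Pi.single i 1}) fun x hx => by
    obtain ⟨t, rfl⟩ := Submodule.mem_span_singleton.1 hx
    simp only [mulVec_smul, dotProduct_smul, smul_dotProduct, smul_eq_mul, mulVec_single_one,
      single_one_dotProduct, col_apply]
    rw [← mul_assoc]
    exact mul_nonneg (mul_self_nonneg t) hi
  rw [finrank_span_singleton (by simp)] at h1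
  omega

theorem negEigCount_le_of_congr {A : Matrix ι ι ℝ} (hA : A.IsHermitian) (B : Matrix ι κ ℝ) :
    negEigCount (Bᵀ * A * B) ≤ negEigCount A := by
  have hBA : (Bᵀ * A * B).IsHermitian := by
    simpa using Matrix.isHermitian_conjTranspose_mul_mul B hA
  obtain ⟨W, hW, hneg⟩ := exists_negative_subspace hBA
  rw [← hW]
  refine finrank_le_negEigCount hA (B.toLin' ∘ₗ W.subtype) fun x hx => ?_
  have := hneg x x.2 (by simpa using hx)
  simpa [← Matrix.mulVec_mulVec, Matrix.dotProduct_transpose_mulVec, dotProduct_comm]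
    using this

theorem negEigCount_submatrix_le {A : Matrix ι ι ℝ} (hA : A.IsHermitian) (φ : κ → ι) :
    negEigCount (A.submatrix φ φ) ≤ negEigCount A := by
  have := negEigCount_le_of_congr hA ((1 : Matrix ι ι ℝ).submatrix id φ)
  convert this using 2
  ext i j
  simp [Matrix.mul_apply, Matrix.one_apply]

theorem negEigCount_submatrix_of_surjective {A : Matrix ι ι ℝ} (hA : A.IsHermitian) {φ : κ → ι}
    (hφ : φ.Surjective) : negEigCount (A.submatrix φ φ) = negEigCount A := by
  refine (negEigCount_submatrix_le hA φ).antisymm ?_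
  obtain ⟨σ, hσ⟩ := hφ.hasRightInverse
  have := negEigCount_submatrix_le (hA.submatrix φ) σ
  rwa [Matrix.submatrix_submatrix, show φ ∘ σ = id from funext hσ, Matrix.submatrix_id_id] at this

theorem negEigCount_smul {A : Matrix ι ι ℝ} (hA : A.IsHermitian) {c : ℝ} (hc : 0 < c) :
    negEigCount (c • A) = negEigCount A := by
  have key {B : Matrix ι ι ℝ} (hB : B.IsHermitian) {c : ℝ} (hc : 0 < c) :
      negEigCount (c • B) ≤ negEigCount B := by
    have := negEigCount_le_of_congr hB (√c • (1 : Matrix ι ι ℝ))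
    simpa [smul_smul, Real.mul_self_sqrt hc.le] using this
  refine (key hA hc).antisymm ?_
  have := key (hA.smul (IsSelfAdjoint.all c)) (inv_pos.2 hc)
  rwa [smul_smul, inv_mul_cancel₀ hc.ne', one_smul] at this

theorem negEigCount_eq_card_roots {A : Matrix ι ι ℝ} (hA : A.IsHermitian) :
    negEigCount A = (A.charpoly.roots.filter (· < 0)).card := by
  classical
  rw [hA.roots_charpoly_eq_eigenvalues, negEigCount, dif_pos hA, Multiset.filter_map,
    Multiset.card_map, Nat.card_eq_fintype_card, Fintype.card_subtype]
  rfl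

theorem negEigCount_fromBlocks_diagonal {A : Matrix ι ι ℝ} {B : Matrix κ κ ℝ}
    (hA : A.IsHermitian) (hB : B.IsHermitian) :
    negEigCount (fromBlocks A 0 0 B) = negEigCount A + negEigCount B := by
  rw [negEigCount_eq_card_roots (hA.fromBlocks (by simp) hB), negEigCount_eq_card_roots hA,
    negEigCount_eq_card_roots hB, Matrix.charpoly_fromBlocks_zero₁₂,
    Polynomial.roots_mul (mul_ne_zero A.charpoly_monic.ne_zero B.charpoly_monic.ne_zero),
    Multiset.filter_add, Multiset.card_add]

theorem negEigCount_blockDiagonal {A : Matrix ι ι ℝ} (hA : A.IsHermitian) :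
    negEigCount (blockDiagonal fun _ : κ => A) = Fintype.card κ * negEigCount A := by
  have hB := isHermitian_blockDiagonal_const (κ := κ) hA
  have hchar : (blockDiagonal fun _ : κ => A).charpoly = A.charpoly ^ Fintype.card κ := by
    have : (blockDiagonal fun _ : κ => A).charmatrix = blockDiagonal fun _ : κ => A.charmatrix := by
      ext ⟨i, k⟩ ⟨j, l⟩ : 1
      by_cases hkl : k = l <;> by_cases hij : i = j <;>
        simp [Matrix.blockDiagonal_apply, hkl, hij]
    rw [Matrix.charpoly, this, Matrix.det_blockDiagonal]
    simp [Matrix.charpoly]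
  rw [negEigCount_eq_card_roots hB, negEigCount_eq_card_roots hA, hchar, Polynomial.roots_pow,
    Multiset.filter_nsmul, Multiset.card_nsmul]

theorem negEigCount_eq_zero {A : Matrix ι ι ℝ} (hA : A.IsHermitian)
    (h : ∀ x, 0 ≤ x ⬝ᵥ A *ᵥ x) : negEigCount A = 0 := by
  have := negEigCount_add_finrank_le hA ⊤ fun x _ => h x
  rw [finrank_top, Module.finrank_fintype_fun_eq_card] at this
  omega

theorem negEigCount_const_unit {x : ℝ} :
    negEigCount (of fun _ _ : Unit => x) = if x < 0 then 1 else 0 := by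
  have hA : (of fun _ _ : Unit => x).IsHermitian := by ext; simp
  split_ifs with hx
  · refine le_antisymm (negEigCount_le_one hA (LinearMap.proj ()) fun y hy => ?_)
      (one_le_negEigCount hA (x := 1) (by simpa [dotProduct, mulVec] using hx))
    have : y = 0 := funext fun _ => hy
    simp [this]
  · refine negEigCount_eq_zero hA fun y => ?_
    simp only [dotProduct, mulVec, Finset.univ_unique, Finset.sum_singleton, of_apply]
    nlinarith [mul_self_nonneg (y default)]

theorem negEigCount_bordered_eq_one_iff {u v a b c : ℝ} (hu : u ≠ 0) :
    negEigCount !![0, u, v; u, a, b; v, b, c] = 1 ↔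
      0 ≤ a * v ^ 2 - 2 * b * u * v + c * u ^ 2 := by
  have hA : (!![0, u, v; u, a, b; v, b, c]).IsHermitian := by
    ext i j
    fin_cases i <;> fin_cases j <;> rfl
  have hform (x : Fin 3 → ℝ) : x ⬝ᵥ !![0, u, v; u, a, b; v, b, c] *ᵥ x =
      2 * x 0 * (u * x 1 + v * x 2) + a * x 1 ^ 2 + 2 * b * x 1 * x 2 + c * x 2 ^ 2 := by
    simp [dotProduct, mulVec, Fin.sum_univ_three]
    ring
  constructor
  · intro h1
    by_contra! hneg
    set δ := a * v ^ 2 - 2 * b * u * v + c * u ^ 2 with hδ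
    let t := (((a * v - b * u) ^ 2 / δ - 1) - a) / (2 * u)
    let l : (Fin 2 → ℝ) →ₗ[ℝ] Fin 3 → ℝ :=
      toLin' !![0, t; v, 1; -u, 0]
    have h2 : finrank ℝ (Fin 2 → ℝ) ≤ _ := finrank_le_negEigCount hA l fun x hx => by
      have hlx : l x = ![t * x 1, v * x 0 + x 1, -u * x 0] := by
        ext i
        fin_cases i <;> simp [l, mulVec, dotProduct, Fin.sum_univ_two]
      have ht : 2 * u * t = (a * v - b * u) ^ 2 / δ - 1 - a := by
        simp only [t]; field_simp
      have hval : l x ⬝ᵥ !![0, u, v; u, a, b; v, b, c] *ᵥ l x =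
          δ * (x 0 + (a * v - b * u) / δ * x 1) ^ 2 - x 1 ^ 2 := by
        rw [hform, hlx]
        simp only [cons_val_zero, cons_val_one, cons_val]
        have : δ * (x 0 + (a * v - b * u) / δ * x 1) ^ 2 - x 1 ^ 2 =
            δ * x 0 ^ 2 + 2 * (a * v - b * u) * x 0 * x 1 +
              ((a * v - b * u) ^ 2 / δ - 1) * x 1 ^ 2 := by
          field_simp [hneg.ne]
          ring
        rw [this, show (a * v - b * u) ^ 2 / δ - 1 = 2 * u * t + a by linarith, hδ]
        ring
      rw [hval]
      by_cases hx1 : x 1 = 0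
      · have hx0 : x 0 ≠ 0 := fun h0 => hx (by ext i; fin_cases i <;> simpa)
        have : 0 < x 0 ^ 2 := by positivity
        rw [hx1]
        nlinarith
      · have : 0 < x 1 ^ 2 := by positivity
        nlinarith [sq_nonneg (x 0 + (a * v - b * u) / δ * x 1)]
    rw [h1, Module.finrank_fintype_fun_eq_card] at h2
    simp at h2
  · intro h
    refine le_antisymm (negEigCount_le_one hA
      (u • LinearMap.proj 1 + v • LinearMap.proj 2) fun x hx => ?_)
      (one_le_negEigCount hA (x := ![(-1 - a) / (2 * u), 1, 0]) ?_)
    · have hs : u * x 1 + v * x 2 = 0 := by simpa using hx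
      have hu2 : 0 < u ^ 2 := by positivity
      rw [hform, hs]
      refine nonneg_of_mul_nonneg_right (a := u ^ 2) ?_ hu2
      have hy : u * x 1 = -v * x 2 := by linarith
      have : u ^ 2 * (2 * x 0 * 0 + a * x 1 ^ 2 + 2 * b * x 1 * x 2 + c * x 2 ^ 2) =
          (a * v ^ 2 - 2 * b * u * v + c * u ^ 2) * x 2 ^ 2 := by
        linear_combination (a * (u * x 1 - v * x 2) + 2 * b * u * x 2) * hy
      rw [this]
      positivity
    · rw [hform]
      have : 2 * ((-1 - a) / (2 * u)) * u = -1 - a := by field_simp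
      simp only [cons_val_zero, cons_val_one, cons_val]
      linarith

theorem negEigCount_fromBlocks_add_const {A : Matrix ι ι ℝ} (hA : A.IsHermitian) (d : ℝ) :
    negEigCount (fromBlocks (A + of fun _ _ => d) (of fun _ _ => d) (of fun _ _ => d)
      (of fun _ _ : Unit => d)) = negEigCount A + if d < 0 then 1 else 0 := by
  have hd : (of fun _ _ : Unit => d).IsHermitian := by ext; simp
  have hdd : (of fun _ _ : ι => d).IsHermitian := by ext; simp
  have hX : (fromBlocks (A + of fun _ _ => d) (of fun _ _ => d) (of fun _ _ => d)
      (of fun _ _ : Unit => d)).IsHermitian :=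
    (hA.add hdd).fromBlocks (by ext; simp) hd
  rw [← negEigCount_const_unit, ← negEigCount_fromBlocks_diagonal hA hd]
  refine le_antisymm ?_ ?_
  · refine le_of_eq_of_le (congrArg negEigCount ?_)
      (negEigCount_le_of_congr (hA.fromBlocks (B := 0) (C := 0) (by simp) hd)
        (fromBlocks 1 0 (of fun _ _ => (1 : ℝ)) 1))
    rw [fromBlocks_transpose, fromBlocks_multiply, fromBlocks_multiply]
    congr 1 <;> ext <;> simp [Matrix.mul_apply]
  · refine le_of_eq_of_le (congrArg negEigCount ?_)
      (negEigCount_le_of_congr hX (fromBlocks 1 0 (of fun _ _ => (-1 : ℝ)) 1))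
    rw [fromBlocks_transpose, fromBlocks_multiply, fromBlocks_multiply]
    congr 1 <;> ext <;> simp [Matrix.mul_apply]

end NegEigCount

section Preserver

theorem eq_mul_of_monotone_of_add {g : ℝ → ℝ} (hmono : Monotone g)
    (hadd : ∀ x y, g (x + y) = g x + g y) (x : ℝ) : g x = g 1 * x := by
  let G : ℝ →+ ℝ := AddMonoidHom.mk' g hadd
  have hint (m : ℤ) : g m = m * g 1 := by
    simpa [G] using map_zsmul G m (1 : ℝ)
  have hnat (n : ℕ) : g (n * x) = n * g x := by
    simpa [G] using map_nsmul G n x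
  by_contra hne
  have hpos : 0 < |g x - g 1 * x| := abs_pos.2 (sub_ne_zero.2 hne)
  have h0 : g 0 = 0 := map_zero G
  have h1 : 0 ≤ g 1 := h0 ▸ hmono zero_le_one
  obtain ⟨n, hn⟩ := exists_nat_gt (g 1 / |g x - g 1 * x|)
  rw [div_lt_iff₀ hpos] at hn
  have hlow := hmono (Int.floor_le (n * x))
  have hupp := hmono (Int.lt_floor_add_one (n * x)).le
  rw [hint, hnat] at hlow
  rw [hadd, hint, hnat] at hupp
  have h2 := mul_le_mul_of_nonneg_right (Int.floor_le (n * x)) h1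
  have h3 := mul_le_mul_of_nonneg_right (Int.lt_floor_add_one (n * x)).le h1
  have : |n * (g x - g 1 * x)| ≤ g 1 := by
    rw [abs_le]
    constructor <;> nlinarith
  rw [abs_mul, Nat.abs_cast] at this
  linarith

theorem exists_homothety_of_preserves_one {g : ℝ → ℝ} (hg0 : g 0 = 0)
    (h : ∀ {ι : Type} [Fintype ι] [DecidableEq ι] (A : Matrix ι ι ℝ), A.IsHermitian →
      negEigCount A = 1 → negEigCount (A.map g) = 1) :
    ∃ c : ℝ, 0 < c ∧ ∀ x : ℝ, g x = c * x := by
  have hneg {x : ℝ} (hx : x < 0) : g x < 0 := by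
    have := h (of fun _ _ : Unit => x) (by ext; simp) (by rw [negEigCount_const_unit, if_pos hx])
    have hmap : (of fun _ _ : Unit => x).map g = of fun _ _ : Unit => g x := rfl
    rw [hmap, negEigCount_const_unit] at this
    simpa using this
  have hbord {u v a b c : ℝ} (hu : u ≠ 0) (hgu : g u ≠ 0)
      (hle : 0 ≤ a * v ^ 2 - 2 * b * u * v + c * u ^ 2) :
      0 ≤ g a * g v ^ 2 - 2 * g b * g u * g v + g c * g u ^ 2 := by
    rw [← negEigCount_bordered_eq_one_iff hgu]
    have := h !![0, u, v; u, a, b; v, b, c]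
      (by ext i j; fin_cases i <;> fin_cases j <;> rfl)
      ((negEigCount_bordered_eq_one_iff hu).2 hle)
    convert this using 2
    ext i j
    fin_cases i <;> fin_cases j <;> simp [hg0]
  have hmid {a b c : ℝ} (hle : 2 * b ≤ a + c) : 2 * g b ≤ g a + g c := by
    have h1 : g (-1) < 0 := hneg (by norm_num)
    have := hbord (u := -1) (v := -1) (a := a) (b := b) (c := c) (by norm_num) h1.ne (by linarith)
    have hsq : 0 < g (-1) ^ 2 := sq_pos_of_neg h1
    nlinarith
  have hodd_pos {x : ℝ} (hx : 0 < x) : g (-x) = -g x := by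
    have hq : g (-x) < 0 := hneg (by linarith)
    have hp : 0 ≤ g x + g (-x) := by
      simpa [hg0] using hmid (a := x) (b := 0) (c := -x) (by linarith)
    have hgx : 0 < g x := by linarith
    have := hbord (u := x) (v := -x) (a := x) (b := 0) (c := -x) hx.ne' hgx.ne'
      (by ring_nf; exact le_rfl)
    rw [hg0] at this
    have hfac : 0 ≤ (g x * -g (-x)) * (-(g x + g (-x))) := by linarith
    have := nonneg_of_mul_nonneg_right hfac (mul_pos hgx (neg_pos.2 hq))
    linarith
  have hodd (x : ℝ) : g (-x) = -g x := by
    rcases lt_trichotomy x 0 with hx | rfl | hx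
    · have := hodd_pos (neg_pos.2 hx)
      rw [neg_neg] at this
      linarith
    · simp [hg0]
    · exact hodd_pos hx
  have hmid_eq {a b c : ℝ} (heq : 2 * b = a + c) : 2 * g b = g a + g c := by
    have h1 := hmid heq.le
    have h2 := hmid (a := -a) (b := -b) (c := -c) (by linarith)
    rw [hodd, hodd, hodd] at h2
    linarith
  have hlin := eq_mul_of_monotone_of_add (g := g)
    (fun a b hab => by have := hmid (a := b) (b := a) (c := b) (by linarith); linarith)
    (fun x y => by
      have h1 := hmid_eq (a := x) (b := (x + y) / 2) (c := y) (by ring)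
      have h2 := hmid_eq (a := x + y) (b := (x + y) / 2) (c := 0) (by ring)
      linarith)
  refine ⟨g 1, ?_, hlin⟩
  have := hneg (x := -1) (by norm_num)
  rw [hodd] at this
  linarith

theorem exists_homothety_of_preserves {k : ℕ} (hk : 1 ≤ k) {g : ℝ → ℝ} (hg0 : g 0 = 0)
    (h : ∀ {ι : Type} [Fintype ι] [DecidableEq ι] (A : Matrix ι ι ℝ), A.IsHermitian →
      negEigCount A = k → negEigCount (A.map g) = k) :
    ∃ c : ℝ, 0 < c ∧ ∀ x : ℝ, g x = c * x := by
  refine exists_homothety_of_preserves_one hg0 fun {ι} _ _ A hA hA1 => ?_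
  have := h (blockDiagonal fun _ : Fin k => A)
    (isHermitian_blockDiagonal_const hA)
    (by simp [negEigCount_blockDiagonal hA, hA1])
  rw [Matrix.blockDiagonal_map _ _ hg0, negEigCount_blockDiagonal (hA.map g fun _ => rfl),
    Fintype.card_fin] at this
  exact Nat.eq_of_mul_eq_mul_left hk (by simpa using this)

theorem MemP.negEigCount_map {k : ℕ} (hk : 1 ≤ k) {f : ℝ → ℝ}
    (h : ∀ a : ℕ → ℕ → ℝ, MemP k a → MemP k (fun i j => f (a i j)))
    {ι : Type} [Fintype ι] [DecidableEq ι] {A : Matrix ι ι ℝ} (hA : A.IsHermitian)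
    (hAk : negEigCount A = k) : negEigCount (A.map f) = k := by
  have hne : Nonempty ι := by
    by_contra hempty
    rw [not_nonempty_iff] at hempty
    have := negEigCount_eq_zero hA fun x => by simp [dotProduct]
    omega
  let e := Fintype.equivFin ι
  let φ : ℕ → ι := fun n =>
    if hn : n < Fintype.card ι then e.symm ⟨n, hn⟩ else Classical.arbitrary ι
  have hφ {n : ℕ} (hn : Fintype.card ι ≤ n) : Function.Surjective fun i : Fin n => φ i := by
    intro i
    refine ⟨⟨e i, (e i).2.trans_le hn⟩, ?_⟩
    simp [φ]
  obtain ⟨-, N, hN⟩ := h (fun i j => A (φ i) (φ j))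
    ⟨fun i j => hA.apply _ _, Fintype.card ι, fun n hn => by
      rw [← hAk, ← negEigCount_submatrix_of_surjective hA (hφ hn)]
      rfl⟩
  rw [← hN (max N (Fintype.card ι)) (le_max_left _ _),
    ← negEigCount_submatrix_of_surjective (hA.map f fun _ => rfl) (hφ (le_max_right N _))]
  rfl

theorem memP_smul {k : ℕ} {a : ℕ → ℕ → ℝ} (ha : MemP k a) {c : ℝ} (hc : 0 < c) :
    MemP k (fun i j => c * a i j) := by
  obtain ⟨hsymm, N, hN⟩ := ha
  refine ⟨fun i j => congrArg (c * ·) (hsymm i j), N, fun n hn => ?_⟩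
  rw [← hN n hn, ← negEigCount_smul (A := of fun i j : Fin n => a i j) _ hc]
  · rfl
  · ext i j
    simp [hsymm j i]

theorem memP_one_const {c : ℝ} (hc : 0 < c) : MemP 1 (fun _ _ => -c) := by
  refine ⟨fun _ _ => rfl, 1, fun n hn => ?_⟩
  have h := negEigCount_submatrix_of_surjective (κ := Fin n)
    (A := of fun _ _ : Unit => -c) (by ext; simp) (φ := fun _ => ()) fun _ => ⟨⟨0, hn⟩, rfl⟩
  rw [negEigCount_const_unit, if_pos (neg_lt_zero.2 hc)] at h
  exact h

/-- Bordering by zeros and applying `f` amounts, by a Schur complement, to subtracting `f 0`. -/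
theorem MemP.negEigCount_map_sub {k : ℕ} (hk : 1 ≤ k) {f : ℝ → ℝ}
    (h : ∀ a : ℕ → ℕ → ℝ, MemP k a → MemP k (fun i j => f (a i j)))
    {ι : Type} [Fintype ι] [DecidableEq ι] {A : Matrix ι ι ℝ} (hA : A.IsHermitian)
    (hAk : negEigCount A = k) :
    negEigCount (A.map fun x => f x - f 0) + (if f 0 < 0 then 1 else 0) = k := by
  have h0 : (of fun _ _ : Unit => (0 : ℝ)).IsHermitian := by ext; simp
  rw [← negEigCount_fromBlocks_add_const (hA.map (fun x => f x - f 0) fun _ => rfl),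
    ← MemP.negEigCount_map hk h (hA.fromBlocks (B := 0) (C := 0) (by simp) h0)
      (by rw [negEigCount_fromBlocks_diagonal hA h0, hAk, negEigCount_const_unit]; simp),
    fromBlocks_map]
  congr 2
  ext
  simp

theorem MemP.forall_neg_of_preserves {k : ℕ} (hk : 1 ≤ k) {f : ℝ → ℝ}
    (h : ∀ a : ℕ → ℕ → ℝ, MemP k a → MemP k (fun i j => f (a i j))) {x : ℝ} (hx : x < 0) :
    f x < 0 := by
  have h1 : (of fun _ _ : Unit => x).IsHermitian := by ext; simp
  have hB := isHermitian_blockDiagonal_const (κ := Fin k) h1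
  have := diag_neg_of_negEigCount_eq_card (hB.map f fun _ => rfl)
    (by rw [MemP.negEigCount_map hk h hB (by
          simp [negEigCount_blockDiagonal h1, negEigCount_const_unit, hx])]; simp)
    ((), ⟨0, hk⟩)
  simpa using this

end Preserver

/-- Theorem 3.7(1): for positive `k`, the entrywise transform `f[-]` maps `𝒫ₖ` into `𝒫ₖ`
if and only if `f` is a positive homothety, or `k = 1` and `f` is a negative constant. -/
theorem pontryagin_gram_preserver_iff (k : ℕ) (hk : 1 ≤ k) (f : ℝ → ℝ) :
    (∀ a : ℕ → ℕ → ℝ, MemP k a → MemP k (fun i j => f (a i j))) ↔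
    ((∃ c : ℝ, 0 < c ∧ ∀ x : ℝ, f x = c * x) ∨
     (k = 1 ∧ ∃ c : ℝ, 0 < c ∧ ∀ x : ℝ, f x = -c)) := by
  constructor
  · intro h
    rcases lt_or_ge (f 0) 0 with hd | hd
    · right
      have hsub {ι : Type} [Fintype ι] [DecidableEq ι] {A : Matrix ι ι ℝ} (hA : A.IsHermitian)
          (hAk : negEigCount A = k) : negEigCount (A.map fun x => f x - f 0) + 1 = k := by
        simpa [hd] using MemP.negEigCount_map_sub hk h hA hAk
      have hk1 : k = 1 := by
        have h1 : (of fun _ _ : Unit => (-1 : ℝ)).IsHermitian := by ext; simp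
        have := hsub (isHermitian_blockDiagonal_const (κ := Fin k) h1) (by simp [negEigCount_blockDiagonal h1, negEigCount_const_unit])
        rw [Matrix.blockDiagonal_map _ (fun x => f x - f 0) (sub_self _),
          negEigCount_blockDiagonal (h1.map (fun x => f x - f 0) fun _ => rfl), Fintype.card_fin] at this
        exact Nat.dvd_one.1 ((Nat.dvd_add_right (Dvd.intro _ rfl)).1 this.symm.dvd)
      subst hk1
      refine ⟨rfl, -f 0, neg_pos.2 hd, fun x => ?_⟩
      rw [neg_neg]
      by_contra hne
      have hx : x ≠ 0 := by rintro rfl; exact hne rfl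
      have h1 := hsub (A := !![0, x, 0; x, 0, 0; 0, 0, 0])
        (by ext i j; fin_cases i <;> fin_cases j <;> rfl)
        ((negEigCount_bordered_eq_one_iff hx).2 (by simp))
      have h2 := (negEigCount_bordered_eq_one_iff (v := 0) (a := 0) (b := 0) (c := 0)
        (sub_ne_zero.2 hne)).2 (by simp)
      have hmap : (!![0, x, 0; x, 0, 0; 0, 0, 0]).map (fun x => f x - f 0) =
          !![0, f x - f 0, 0; f x - f 0, 0, 0; 0, 0, 0] := by
        ext i j
        fin_cases i <;> fin_cases j <;> simp
      rw [hmap] at h1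
      omega
    · left
      obtain ⟨c, hc, hlin⟩ := exists_homothety_of_preserves hk (g := fun x => f x - f 0)
        (sub_self _) fun A hA hAk => by
          simpa [hd.not_gt] using MemP.negEigCount_map_sub hk h hA hAk
      refine ⟨c, hc, fun x => ?_⟩
      have hd0 : f 0 = 0 := by
        by_contra hne
        have hpos : 0 < f 0 := lt_of_le_of_ne hd (Ne.symm hne)
        have h1 := MemP.forall_neg_of_preserves hk h (x := -(f 0 / c)) (by simp; positivity)
        have h2 := hlin (-(f 0 / c))
        have h3 : c * -(f 0 / c) = -f 0 := by field_simp
        simp only [h3] at h2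
        linarith
      simpa [hd0] using hlin x
  · rintro (⟨c, hc, hf⟩ | ⟨rfl, c, hc, hf⟩) a ha
    · simpa only [hf] using memP_smul ha hc
    · simpa only [hf] using memP_one_const hc
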